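/- Let k,p>0 be integers, d = 1 + 2^(-k), ε = 2^(-p), and v ∈ ℝ. Let W and V be infinite real sequences, each bounded by some μ>0, with DSum(V,d) = v, and let W−V denote their entrywise difference. Then: if DSLow(W−V) ≥ 0 then DSum(W,d) ≥ v, and if DSLow(W−V) < 0 then DSum(W,d) < v + d·ε. -/

import Mathlib

open Filter Topology

/-- `roundLow r x` is the largest integer multiple of the resolution `r` that is `≤ x`. -/
noncomputable def roundLow (r x : ℝ) : ℝ := ⌊x / r⌋ * r

/-- Lower gap value of a finite real sequence: `gapLow [] = 0`,
`gapLow (V ++ [v]) = roundLow (d * gapLow V + v)`. -/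
noncomputable def gapLow (d r : ℝ) (W : List ℝ) : ℝ :=
  W.foldl (fun g w => roundLow r (d * g + w)) 0

/-- Gap value of a finite real sequence: `gap [] = 0`, `gap (V ++ [v]) = d * gap V + v`. -/
def gap (d : ℝ) (W : List ℝ) : ℝ :=
  W.foldl (fun g w => d * g + w) 0

/-- The `n`-length prefix of an infinite sequence. -/
def pre (W : ℕ → ℝ) (n : ℕ) : List ℝ := (List.range n).map W

theorem gapLow_pre_succ (d r : ℝ) (U : ℕ → ℝ) (n : ℕ) :
    gapLow d r (pre U (n + 1)) = roundLow r (d * gapLow d r (pre U n) + U n) := by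
  simp [gapLow, pre, List.range_succ]

theorem roundLow_le {r : ℝ} (hr : 0 < r) (x : ℝ) : roundLow r x ≤ x :=
  (le_div_iff₀ hr).1 (Int.floor_le (x / r))

theorem le_roundLow_add {r : ℝ} (hr : 0 < r) (x : ℝ) : x ≤ roundLow r x + r := by
  have h := (div_lt_iff₀ hr).1 (Int.lt_floor_add_one (x / r))
  unfold roundLow
  linarith

/-- The error accumulated by rounding, scaled back, lies between `0` and `d * ε`. -/
theorem sum_sub_gapLow_bounds {d ε : ℝ} (hd : 1 < d) (hε : 0 < ε) (U : ℕ → ℝ) (n : ℕ) :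
    0 ≤ ∑ i ∈ Finset.range n, U i / d ^ i
        - gapLow d (ε * (d - 1)) (pre U n) * d / d ^ n ∧
      ∑ i ∈ Finset.range n, U i / d ^ i - gapLow d (ε * (d - 1)) (pre U n) * d / d ^ n
        ≤ d * ε * (1 - 1 / d ^ n) := by
  have hr : 0 < ε * (d - 1) := mul_pos hε (by linarith)
  have hd0 : 0 < d := by linarith
  induction n with
  | zero => simp [gapLow, pre]
  | succ n ih =>
    rw [gapLow_pre_succ, Finset.sum_range_succ]
    set g := gapLow d (ε * (d - 1)) (pre U n)
    have hlow := roundLow_le hr (d * g + U n)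
    have hup := le_roundLow_add hr (d * g + U n)
    set g' := roundLow (ε * (d - 1)) (d * g + U n)
    have hpow : 0 < d ^ n := pow_pos hd0 n
    have hstep : U n / d ^ n - g' * d / d ^ (n + 1)
        = (d * g + U n - g') / d ^ n - g * d / d ^ n := by
      rw [pow_succ]
      field_simp
      ring
    have hgeom : d * ε * (1 - 1 / d ^ (n + 1))
        = d * ε * (1 - 1 / d ^ n) + ε * (d - 1) / d ^ n := by
      rw [pow_succ]
      field_simp
      ring
    have h0 : 0 ≤ (d * g + U n - g') / d ^ n := div_nonneg (by linarith) hpow.le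
    have h1 : (d * g + U n - g') / d ^ n ≤ ε * (d - 1) / d ^ n := by
      gcongr
      linarith
    rw [hgeom]
    constructor <;> linarith [ih.1, ih.2]

theorem summable_div_pow_of_bounded {d : ℝ} (hd : 1 < d) {U : ℕ → ℝ}
    (hU : ∃ μ > 0, ∀ i, |U i| ≤ μ) : Summable fun i => U i / d ^ i := by
  obtain ⟨μ, -, hμ⟩ := hU
  have hd0 : 0 < d := by linarith
  refine Summable.of_norm_bounded (g := fun i => μ * d⁻¹ ^ i)
    ((summable_geometric_of_lt_one (by positivity) (inv_lt_one_of_one_lt₀ hd)).mul_left μ)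
    fun i => ?_
  rw [Real.norm_eq_abs, abs_div, abs_of_pos (pow_pos hd0 i), inv_pow, ← div_eq_mul_inv]
  gcongr
  exact hμ i

/-- For integers k,p>0, d = 1+2^(-k), ε = 2^(-p), v ∈ ℝ, and infinite
real sequences W, V each bounded by some μ>0 with DSum(V,d) = v: if DSLow(W−V) ≥ 0 then
DSum(W,d) ≥ v, and if DSLow(W−V) < 0 then DSum(W,d) < v + d·ε. -/
theorem stmt_13 (k p : ℕ) (hk : 0 < k) (hp : 0 < p)
    (d ε r : ℝ) (hd : d = 1 + 2 ^ (-(k : ℤ))) (hε : ε = 2 ^ (-(p : ℤ)))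
    (hr : r = 2 ^ (-((p : ℤ) + k)))
    (v : ℝ) (W V : ℕ → ℝ)
    (hWb : ∃ μ > 0, ∀ i, |W i| ≤ μ) (hVb : ∃ μ > 0, ∀ i, |V i| ≤ μ)
    (hV : (∑' i, V i / d ^ i) = v)
    (L : ℝ)
    (hL : Tendsto (fun n => gapLow d r (pre (fun i => W i - V i) n) / d ^ (n - 1))
      atTop (𝓝 L)) :
    (0 ≤ L → v ≤ ∑' i, W i / d ^ i) ∧
      (L < 0 → (∑' i, W i / d ^ i) < v + d * ε) := by
  have hε0 : 0 < ε := by rw [hε]; positivity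
  have hd1 : 1 < d := by
    rw [hd]
    have : (0 : ℝ) < 2 ^ (-(k : ℤ)) := by positivity
    linarith
  have hd0 : 0 < d := by linarith
  have hrε : r = ε * (d - 1) := by
    rw [hr, hε, hd, add_sub_cancel_left, ← zpow_add₀ two_ne_zero, neg_add]
  have hW := summable_div_pow_of_bounded hd1 hWb
  have hV' := summable_div_pow_of_bounded hd1 hVb
  have hsum : HasSum (fun i => (W i - V i) / d ^ i) ((∑' i, W i / d ^ i) - v) := by
    rw [← hV]
    simpa only [sub_div] using hW.hasSum.sub hV'.hasSum
  have hlim := (tendsto_add_atTop_iff_nat 1).2 (hsum.tendsto_sum_nat.sub hL)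
  have hscale (n : ℕ) (x : ℝ) : x * d / d ^ (n + 1) = x / d ^ n := by
    rw [pow_succ, mul_div_mul_right _ _ hd0.ne']
  have hbounds (n : ℕ) := sum_sub_gapLow_bounds hd1 hε0 (fun i => W i - V i) (n + 1)
  simp only [hscale, ← hrε] at hbounds
  have hge := ge_of_tendsto' hlim fun n => (hbounds n).1
  have hle := le_of_tendsto' hlim fun n => (hbounds n).2.trans <|
    mul_le_of_le_one_right (by positivity) (sub_le_self 1 (by positivity))
  constructor <;> intro h <;> linarith
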